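/- arXiv:2201.10784 — 2 statements merged into one kernel-verified Lean document; each statement's English description precedes it below -/
import Mathlib

section
/- (Solution of the Cauchy problem for the third-order operator.) Let λ ∈ ℂ with λ ≠ 0, let y₀, y₁, y₂ ∈ ℂ, and let f : ℝ → ℂ be continuous. Define y(x) = y₀·s₀(iλx) + y₁·s₁(iλx)/(iλ) + y₂·s₂(iλx)/(iλ)² − i·∫₀ˣ (s₂(iλ(x−t))/(iλ)²)·f(t) dt. Then y is three times continuously differentiable on ℝ, satisfies i·y'''(x) = λ³·y(x) + f(x) for all x ∈ ℝ, and y(0) = y₀, y'(0) = y₁, y''(0) = y₂. -/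
open Complex

noncomputable def ζ₁ : ℂ := 1
noncomputable def ζ₂ : ℂ := (-1 + Real.sqrt 3 * Complex.I) / 2
noncomputable def ζ₃ : ℂ := (-1 - Real.sqrt 3 * Complex.I) / 2

/-- `sfun p z = (1/3)·(ζ₁^(−p)·e^{zζ₁} + ζ₂^(−p)·e^{zζ₂} + ζ₃^(−p)·e^{zζ₃})`. -/
noncomputable def sfun (p : ℕ) (z : ℂ) : ℂ :=
  ((ζ₁ ^ p)⁻¹ * Complex.exp (z * ζ₁) + (ζ₂ ^ p)⁻¹ * Complex.exp (z * ζ₂) +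
    (ζ₃ ^ p)⁻¹ * Complex.exp (z * ζ₃)) / 3

theorem ζ₂_sq : ζ₂ ^ 2 = -1 - ζ₂ := by
  have h3 : ((Real.sqrt 3 : ℝ) : ℂ) ^ 2 = 3 := by
    norm_cast; simp
  unfold ζ₂
  linear_combination (1 / 4 : ℂ) * (Real.sqrt 3 : ℂ) ^ 2 * I_sq - (1 / 4 : ℂ) * h3

theorem ζ₃_eq : ζ₃ = -1 - ζ₂ := by
  unfold ζ₂ ζ₃
  ring

theorem ζ₂_cube : ζ₂ ^ 3 = 1 := by
  linear_combination (ζ₂ - 1) * ζ₂_sq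

theorem ζ₃_cube : ζ₃ ^ 3 = 1 := by
  rw [ζ₃_eq]
  linear_combination (-ζ₂ - 2) * ζ₂_sq

theorem ζ₂_ne_zero : ζ₂ ≠ 0 := fun h => by simpa [h] using ζ₂_cube

theorem ζ₃_ne_zero : ζ₃ ≠ 0 := fun h => by simpa [h] using ζ₃_cube

theorem sfun_add_three (p : ℕ) (z : ℂ) : sfun (p + 3) z = sfun p z := by
  simp [sfun, pow_add, ζ₂_cube, ζ₃_cube, ζ₁]

theorem sfun_zero_zero : sfun 0 0 = 1 := by
  norm_num [sfun]

theorem sfun_one_zero : sfun 1 0 = 0 := by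
  have h₂ : ζ₂⁻¹ = ζ₂ ^ 2 := inv_eq_of_mul_eq_one_left (by linear_combination ζ₂_cube)
  have h₃ : ζ₃⁻¹ = ζ₃ ^ 2 := inv_eq_of_mul_eq_one_left (by linear_combination ζ₃_cube)
  simp only [sfun, pow_one, h₂, h₃, ζ₁, zero_mul, exp_zero]
  rw [ζ₃_eq]
  linear_combination (2 / 3 : ℂ) * ζ₂_sq

theorem sfun_two_zero : sfun 2 0 = 0 := by
  have h₂ : (ζ₂ ^ 2)⁻¹ = ζ₂ := inv_eq_of_mul_eq_one_left (by linear_combination ζ₂_cube)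
  have h₃ : (ζ₃ ^ 2)⁻¹ = ζ₃ := inv_eq_of_mul_eq_one_left (by linear_combination ζ₃_cube)
  simp only [sfun, h₂, h₃, ζ₁, zero_mul, exp_zero]
  rw [ζ₃_eq]
  ring

theorem hasDerivAt_sfun_succ (p : ℕ) (z : ℂ) : HasDerivAt (sfun (p + 1)) (sfun p z) z := by
  have h (c : ℂ) : HasDerivAt (fun z => exp (z * c)) (exp (z * c) * c) z := by
    simpa using ((hasDerivAt_id z).mul_const c).cexp
  refine (((((h ζ₁).const_mul (ζ₁ ^ (p + 1))⁻¹).add ((h ζ₂).const_mul (ζ₂ ^ (p + 1))⁻¹)).add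
    ((h ζ₃).const_mul (ζ₃ ^ (p + 1))⁻¹)).div_const 3).congr_deriv ?_
  have h₁ : ζ₁ ≠ 0 := one_ne_zero
  have h₂ := ζ₂_ne_zero
  have h₃ := ζ₃_ne_zero
  unfold sfun
  field_simp
  ring

theorem hasDerivAt_sfun_mul_ofReal (p : ℕ) (k : ℂ) (x : ℝ) :
    HasDerivAt (fun x : ℝ => sfun (p + 1) (k * x)) (k * sfun p (k * x)) x := by
  have h : HasDerivAt (fun x : ℝ => k * (x : ℂ)) k x := by
    simpa using (Complex.ofRealCLM.hasDerivAt (x := x)).const_mul k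
  exact ((hasDerivAt_sfun_succ p (k * x)).comp x h).congr_deriv (mul_comm _ _)

/-- Variation of constants for the first-order linear equation with constant coefficient `a`. -/
theorem hasDerivAt_integral_exp_mul {f : ℝ → ℂ} (hf : Continuous f) (a : ℂ) (x : ℝ) :
    HasDerivAt (fun x : ℝ => ∫ t in (0 : ℝ)..x, exp (a * ((x : ℂ) - t)) * f t)
      (a * (∫ t in (0 : ℝ)..x, exp (a * ((x : ℂ) - t)) * f t) + f x) x := by
  have hsplit (x : ℝ) : ∫ t in (0 : ℝ)..x, exp (a * ((x : ℂ) - t)) * f t =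
      exp (a * x) * ∫ t in (0 : ℝ)..x, exp (-(a * t)) * f t := by
    rw [← intervalIntegral.integral_const_mul]
    refine intervalIntegral.integral_congr fun t _ => ?_
    simp only [sub_eq_add_neg, mul_add, exp_add, mul_neg, mul_assoc]
  have hg : Continuous fun t : ℝ => exp (-(a * t)) * f t := by fun_prop
  have hexp : HasDerivAt (fun x : ℝ => exp (a * x)) (exp (a * x) * a) x := by
    simpa using ((Complex.ofRealCLM.hasDerivAt (x := x)).const_mul a).cexp
  simp only [hsplit]
  refine (hexp.mul (hg.integral_hasStrictDerivAt 0 x).hasDerivAt).congr_deriv ?_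
  have hcancel : exp (a * x) * exp (-(a * x)) = 1 := by rw [← exp_add]; simp
  linear_combination f x * hcancel

theorem integral_sfun_mul {f : ℝ → ℂ} (hf : Continuous f) (p : ℕ) (k : ℂ) (x : ℝ) :
    ∫ t in (0 : ℝ)..x, sfun p (k * ((x : ℂ) - t)) * f t =
      ((ζ₁ ^ p)⁻¹ * (∫ t in (0 : ℝ)..x, exp (k * ζ₁ * ((x : ℂ) - t)) * f t) +
        (ζ₂ ^ p)⁻¹ * (∫ t in (0 : ℝ)..x, exp (k * ζ₂ * ((x : ℂ) - t)) * f t) +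
        (ζ₃ ^ p)⁻¹ * (∫ t in (0 : ℝ)..x, exp (k * ζ₃ * ((x : ℂ) - t)) * f t)) / 3 := by
  have hInt (b a : ℂ) : IntervalIntegrable
      (fun t : ℝ => b * (exp (a * ((x : ℂ) - t)) * f t)) MeasureTheory.volume 0 x :=
    Continuous.intervalIntegrable (by fun_prop) _ _
  simp only [← intervalIntegral.integral_const_mul]
  rw [← intervalIntegral.integral_add (hInt _ _) (hInt _ _),
    ← intervalIntegral.integral_add ((hInt _ _).add (hInt _ _)) (hInt _ _),
    ← intervalIntegral.integral_div]
  refine intervalIntegral.integral_congr fun t _ => ?_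
  simp only [sfun, mul_right_comm k _ ((x : ℂ) - t)]
  ring

theorem hasDerivAt_integral_sfun_mul {f : ℝ → ℂ} (hf : Continuous f) (p : ℕ) (k : ℂ) (x : ℝ) :
    HasDerivAt (fun x : ℝ => ∫ t in (0 : ℝ)..x, sfun (p + 1) (k * ((x : ℂ) - t)) * f t)
      (k * (∫ t in (0 : ℝ)..x, sfun p (k * ((x : ℂ) - t)) * f t) + sfun (p + 1) 0 * f x) x := by
  have h (c : ℂ) := hasDerivAt_integral_exp_mul hf (k * c) x
  simp only [integral_sfun_mul hf]
  refine (((((h ζ₁).const_mul (ζ₁ ^ (p + 1))⁻¹).add ((h ζ₂).const_mul (ζ₂ ^ (p + 1))⁻¹)).add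
    ((h ζ₃).const_mul (ζ₃ ^ (p + 1))⁻¹)).div_const 3).congr_deriv ?_
  have h₁ : ζ₁ ≠ 0 := one_ne_zero
  have h₂ := ζ₂_ne_zero
  have h₃ := ζ₃_ne_zero
  simp only [sfun, zero_mul, exp_zero]
  field_simp
  ring

/-- The Cauchy solution with all indices of the functions `sfun` shifted by `p`; up to powers of
`k`, these are the successive derivatives of the solution. -/
noncomputable def cauchySol (k y0 y1 y2 : ℂ) (f : ℝ → ℂ) (p : ℕ) (x : ℝ) : ℂ :=
  y0 * sfun p (k * x) + y1 / k * sfun (p + 1) (k * x) + y2 / k ^ 2 * sfun (p + 2) (k * x) -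
    I / k ^ 2 * ∫ t in (0 : ℝ)..x, sfun (p + 2) (k * ((x : ℂ) - t)) * f t

theorem hasDerivAt_cauchySol_succ {f : ℝ → ℂ} (hf : Continuous f) (k y0 y1 y2 : ℂ) (p : ℕ)
    (x : ℝ) :
    HasDerivAt (cauchySol k y0 y1 y2 f (p + 1))
      (k * cauchySol k y0 y1 y2 f p x - I / k ^ 2 * (sfun p 0 * f x)) x := by
  refine (((((hasDerivAt_sfun_mul_ofReal p k x).const_mul y0).add
    ((hasDerivAt_sfun_mul_ofReal (p + 1) k x).const_mul (y1 / k))).add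
    ((hasDerivAt_sfun_mul_ofReal (p + 2) k x).const_mul (y2 / k ^ 2))).sub
    ((hasDerivAt_integral_sfun_mul hf (p + 2) k x).const_mul (I / k ^ 2))).congr_deriv ?_
  rw [show p + 2 + 1 = p + 3 from rfl, sfun_add_three, cauchySol]
  ring

theorem cauchySol_add_three (k y0 y1 y2 : ℂ) (f : ℝ → ℂ) (p : ℕ) :
    cauchySol k y0 y1 y2 f (p + 3) = cauchySol k y0 y1 y2 f p := by
  funext x
  simp only [cauchySol, sfun_add_three, add_right_comm p 3]

open intervalIntegral in
theorem stmt9 (lam : ℂ) (hlam : lam ≠ 0) (y0 y1 y2 : ℂ) (f : ℝ → ℂ) (hf : Continuous f)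
    (y : ℝ → ℂ)
    (hy : ∀ x : ℝ, y x =
      y0 * sfun 0 (Complex.I * lam * x) + y1 * sfun 1 (Complex.I * lam * x) / (Complex.I * lam) +
        y2 * sfun 2 (Complex.I * lam * x) / (Complex.I * lam) ^ 2 -
        Complex.I * ∫ t in (0:ℝ)..x,
          sfun 2 (Complex.I * lam * ((x : ℂ) - (t : ℂ))) / (Complex.I * lam) ^ 2 * f t) :
    ContDiff ℝ 3 y ∧
    (∀ x : ℝ, Complex.I * iteratedDeriv 3 y x = lam ^ 3 * y x + f x) ∧
    y 0 = y0 ∧ deriv y 0 = y1 ∧ iteratedDeriv 2 y 0 = y2 := by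
  set k : ℂ := I * lam with hk
  have hk0 : k ≠ 0 := mul_ne_zero I_ne_zero hlam
  set G := cauchySol k y0 y1 y2 f with hG
  have hyG : y = G 0 := by
    funext x
    rw [hy x, hG, cauchySol]
    simp only [div_mul_eq_mul_div, intervalIntegral.integral_div]
    ring_nf
  have hd0 (x : ℝ) : HasDerivAt y (k * G 2 x) x := by
    rw [hyG, hG, ← cauchySol_add_three]
    simpa [sfun_two_zero] using hasDerivAt_cauchySol_succ hf k y0 y1 y2 2 x
  have hd2 (x : ℝ) : HasDerivAt (G 2) (k * G 1 x) x := by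
    simpa [sfun_one_zero] using hasDerivAt_cauchySol_succ hf k y0 y1 y2 1 x
  have hd1 (x : ℝ) : HasDerivAt (G 1) (k * y x - I / k ^ 2 * f x) x := by
    simpa [sfun_zero_zero, hyG] using hasDerivAt_cauchySol_succ hf k y0 y1 y2 0 x
  have e1 : deriv y = fun x => k * G 2 x := funext fun x => (hd0 x).deriv
  have e2 : deriv (fun x => k * G 2 x) = fun x => k * (k * G 1 x) :=
    funext fun x => ((hd2 x).const_mul k).deriv
  have e3 : deriv (fun x => k * (k * G 1 x)) = fun x => k * (k * (k * y x - I / k ^ 2 * f x)) :=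
    funext fun x => (((hd1 x).const_mul k).const_mul k).deriv
  have hi2 : iteratedDeriv 2 y = fun x => k * (k * G 1 x) := by
    rw [iteratedDeriv_succ, iteratedDeriv_one, e1, e2]
  have hi3 : iteratedDeriv 3 y = fun x => k * (k * (k * y x - I / k ^ 2 * f x)) := by
    rw [iteratedDeriv_succ, hi2, e3]
  have hdiff : Differentiable ℝ y := fun x => (hd0 x).differentiableAt
  have hcont : Continuous y := hdiff.continuous
  refine ⟨?_, fun x => ?_, ?_, ?_, ?_⟩
  · have hC1 : ContDiff ℝ 1 (G 1) := contDiff_one_iff_deriv.2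
      ⟨fun x => (hd1 x).differentiableAt, by
        rw [funext fun x => (hd1 x).deriv]
        fun_prop⟩
    have hC2 : ContDiff ℝ (1 + 1) (G 2) := contDiff_succ_iff_deriv.2
      ⟨fun x => (hd2 x).differentiableAt, by simp, by
        rw [funext fun x => (hd2 x).deriv]
        exact contDiff_const.mul hC1⟩
    rw [show (3 : WithTop ℕ∞) = 1 + 1 + 1 by norm_num]
    exact contDiff_succ_iff_deriv.2 ⟨hdiff, by norm_num, e1 ▸ contDiff_const.mul hC2⟩
  · rw [hi3]
    field_simp
    rw [hk]
    linear_combination (lam ^ 3 * y x * (I ^ 2 - 1) - f x) * I_sq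
  · simp [hyG, hG, cauchySol, sfun_zero_zero, sfun_one_zero, sfun_two_zero]
  · rw [e1]
    simp [hG, cauchySol, sfun_add_three 0, sfun_add_three 1, sfun_zero_zero, sfun_one_zero,
      sfun_two_zero]
    field_simp
  · rw [hi2]
    simp [hG, cauchySol, sfun_add_three 0, sfun_zero_zero, sfun_one_zero, sfun_two_zero]
    field_simp
end

section
/- Define m_{s₀}(λ) = (1/3)·(m₁(λ) + m₂(λ) + m₃(λ)) and, for λ ≠ 0, m_{s₂}(λ) = (ζ₁m₁(λ) + ζ₂m₂(λ) + ζ₃m₃(λ))/(3·(iλ)²). Then for every λ ∈ ℂ with 0 < |λ| < a/3: m_{s₂}(λ) + m_{s₂}*(λ) = (1/(3(iλ)²))·(q̃₁(λ)q̃₁*(λ) + ζ₂·q̃₂(λ)q̃₃*(λ) + ζ₃·q̃₃(λ)q̃₂*(λ)); m_{s₀}(λ) + m_{s₀}*(λ) = (1/3)·(q̃₁(λ)q̃₁*(λ) + q̃₂(λ)q̃₃*(λ) + q̃₃(λ)q̃₂*(λ)); and both functions are invariant under rotation: m_{s₂}(ζ₂λ) = m_{s₂}(λ) and m_{s₀}(ζ₂λ)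 = m_{s₀}(λ). -/
open Complex

open MeasureTheory Set

/-- q̃ for direction ζ: `∫₀^∞ e^{−iλζx} q(x) dx`. -/
noncomputable def qt (q : ℝ → ℂ) (ζ lam : ℂ) : ℂ :=
  ∫ x in Ioi (0:ℝ), Complex.exp (-Complex.I * lam * ζ * x) * q x

/-- Autocorrelation `g_q(s) = ∫₀^∞ q(x+s) conj(q(x)) dx`. -/
noncomputable def gq (q : ℝ → ℂ) (s : ℝ) : ℂ :=
  ∫ x in Ioi (0:ℝ), q (x + s) * (starRingEnd ℂ) (q x)

/-- `m_k(λ) = ∫₀^∞ e^{−iλζ_k s} g_q(s) ds`. -/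
noncomputable def mker (q : ℝ → ℂ) (ζ lam : ℂ) : ℂ :=
  ∫ s in Ioi (0:ℝ), Complex.exp (-Complex.I * lam * ζ * s) * gq q s

/-- `f*(λ) = conj (f (conj λ))`. -/
noncomputable def starF (f : ℂ → ℂ) (lam : ℂ) : ℂ :=
  (starRingEnd ℂ) (f ((starRingEnd ℂ) lam))

/-- `m_{s₀}(λ) = (m₁(λ)+m₂(λ)+m₃(λ))/3`. -/
noncomputable def ms0 (q : ℝ → ℂ) (lam : ℂ) : ℂ :=
  (mker q ζ₁ lam + mker q ζ₂ lam + mker q ζ₃ lam) / 3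

/-- `m_{s₂}(λ) = (ζ₁m₁(λ)+ζ₂m₂(λ)+ζ₃m₃(λ))/(3(iλ)²)`. -/
noncomputable def ms2 (q : ℝ → ℂ) (lam : ℂ) : ℂ :=
  (ζ₁ * mker q ζ₁ lam + ζ₂ * mker q ζ₂ lam + ζ₃ * mker q ζ₃ lam) /
    (3 * (Complex.I * lam) ^ 2)

/-- `b(λ) = 1 + iα m_{s₂}(λ)`. -/
noncomputable def bcoef (α : ℝ) (q : ℝ → ℂ) (lam : ℂ) : ℂ :=
  1 + Complex.I * α * ms2 q lam

/-- Generic Jost solution with oscillation direction `ζk` and coefficient direction `ζc`. -/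
noncomputable def jost (α : ℝ) (q : ℝ → ℂ) (ζk ζc : ℂ) (lam : ℂ) (x : ℝ) : ℂ :=
  bcoef α q lam * Complex.exp (Complex.I * lam * ζk * x) -
    Complex.I * α * starF (qt q ζc) lam *
      ∫ t in Ioi x, sfun 2 (Complex.I * lam * ((x : ℂ) - (t : ℂ))) / (Complex.I * lam) ^ 2 * q t

/-- `ψ₁(λ,x)`. -/
noncomputable def psi1 (α : ℝ) (q : ℝ → ℂ) (lam : ℂ) (x : ℝ) : ℂ := jost α q ζ₁ ζ₁ lam x

/-- `ψ₂(λ,x)`. -/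
noncomputable def psi2 (α : ℝ) (q : ℝ → ℂ) (lam : ℂ) (x : ℝ) : ℂ := jost α q ζ₂ ζ₃ lam x

/-- `ψ₃(λ,x)`. -/
noncomputable def psi3 (α : ℝ) (q : ℝ → ℂ) (lam : ℂ) (x : ℝ) : ℂ := jost α q ζ₃ ζ₂ lam x

/-- Splitting `∫ f · ∫ h` along the correlation of `f` and `h` over positive and negative shifts. -/
theorem integral_mul_integral_eq_correlation {f h : ℝ → ℂ} (hf : Integrable f) (hh : Integrable h) :
    (∫ x, f x) * ∫ y, h y =
      (∫ s in Ioi (0:ℝ), ∫ y, f (y + s) * h y) + ∫ s in Ioi (0:ℝ), ∫ y, f y * h (y + s) := by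
  have hconv : ∀ s, convolution (fun t => h (-t)) f (ContinuousLinearMap.mul ℝ ℂ) volume s =
      ∫ y, f (y + s) * h y := by
    intro s
    rw [convolution_def, ← integral_neg_eq_self]
    refine integral_congr_ae (Filter.Eventually.of_forall fun y => ?_)
    simp [mul_comm, add_comm, sub_eq_add_neg]
  have hi := hh.comp_neg.integrable_convolution (ContinuousLinearMap.mul ℝ ℂ) hf
  have hc := integral_convolution (ContinuousLinearMap.mul ℝ ℂ) (μ := volume) (ν := volume)
    hh.comp_neg hf
  rw [funext hconv] at hi
  simp only [hconv, ContinuousLinearMap.mul_apply', integral_neg_eq_self] at hc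
  rw [mul_comm, ← hc, ← integral_add_compl (measurableSet_Ioi (a := (0:ℝ))) hi]
  congr 1
  rw [compl_Ioi, ← neg_zero, ← integral_comp_neg_Ioi, neg_zero]
  refine setIntegral_congr_fun measurableSet_Ioi fun s _ => ?_
  rw [← integral_add_right_eq_self _ s]
  simp

theorem integrableOn_exp_mul_of_weighted_sq {a : ℝ} {q : ℝ → ℂ} (hq : Measurable q)
    (hint : IntegrableOn (fun x => Real.exp (2 * a * x) * ‖q x‖ ^ 2) (Ioi 0))
    {w : ℂ} (hw : ‖w‖ < a) :
    IntegrableOn (fun x : ℝ => Complex.exp (w * x) * q x) (Ioi 0) := by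
  have hdec : IntegrableOn (fun x : ℝ => Real.exp ((2 * (‖w‖ - a)) * x)) (Ioi 0) :=
    integrableOn_exp_mul_Ioi (by linarith) 0
  refine Integrable.mono' (hdec.add hint) ?_ ?_
  · exact Measurable.aestronglyMeasurable (by fun_prop)
  · filter_upwards [ae_restrict_mem measurableSet_Ioi] with x hx
    have hx0 : (0:ℝ) < x := hx
    have hre : (w * x).re ≤ (‖w‖ - a) * x + a * x := by
      have := mul_le_mul_of_nonneg_right (Complex.re_le_norm w) hx0.le
      simp only [Complex.re_mul_ofReal]
      linarith
    have h1 : Real.exp ((w * x).re) ≤ Real.exp ((‖w‖ - a) * x) * Real.exp (a * x) := by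
      rw [← Real.exp_add]; exact Real.exp_le_exp.mpr hre
    have h2 : Real.exp ((2 * (‖w‖ - a)) * x) = Real.exp ((‖w‖ - a) * x) ^ 2 := by
      rw [← Real.exp_nat_mul]; push_cast; ring_nf
    have h3 : Real.exp (2 * a * x) = Real.exp (a * x) ^ 2 := by
      rw [← Real.exp_nat_mul]; push_cast; ring_nf
    simp only [Pi.add_apply, norm_mul, Complex.norm_exp]
    rw [h2, h3]
    have h4 := mul_le_mul_of_nonneg_right h1 (norm_nonneg (q x))
    nlinarith [sq_nonneg (Real.exp ((‖w‖ - a) * x) - Real.exp (a * x) * ‖q x‖),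
      sq_nonneg (Real.exp (a * x) * ‖q x‖), sq_nonneg (Real.exp ((‖w‖ - a) * x))]

theorem integral_indicator_exp_correlation (p r : ℝ → ℂ) (u v : ℂ) (huv : u + v = 0)
    {s : ℝ} (hs : 0 < s) :
    ∫ y, (Ioi (0:ℝ)).indicator (fun x : ℝ => Complex.exp (u * x) * p x) (y + s) *
        (Ioi (0:ℝ)).indicator (fun x : ℝ => Complex.exp (v * x) * r x) y =
      Complex.exp (u * s) * ∫ y in Ioi (0:ℝ), p (y + s) * r y := by
  rw [← integral_const_mul, ← integral_indicator measurableSet_Ioi]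
  refine integral_congr_ae (Filter.Eventually.of_forall fun y => ?_)
  by_cases hy : y ∈ Ioi (0:ℝ)
  · have hys : y + s ∈ Ioi (0:ℝ) := add_pos (mem_Ioi.mp hy) hs
    simp only [indicator_of_mem hy, indicator_of_mem hys]
    have : Complex.exp (u * s) = Complex.exp (u * ((y + s : ℝ) : ℂ)) * Complex.exp (v * y) := by
      rw [← Complex.exp_add, eq_neg_of_add_eq_zero_right huv]
      congr 1; push_cast; ring
    rw [this]; ring
  · simp only [indicator_of_notMem hy, mul_zero]

theorem starF_qt (q : ℝ → ℂ) (ζ lam : ℂ) :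
    starF (qt q ζ) lam = ∫ x in Ioi (0:ℝ),
      Complex.exp (Complex.I * lam * (starRingEnd ℂ) ζ * x) * (starRingEnd ℂ) (q x) := by
  rw [starF, qt, ← integral_conj]
  simp [← Complex.exp_conj]

theorem starF_mker (q : ℝ → ℂ) (ζ lam : ℂ) :
    starF (mker q ζ) lam = ∫ s in Ioi (0:ℝ),
      Complex.exp (Complex.I * lam * (starRingEnd ℂ) ζ * s) *
        ∫ x in Ioi (0:ℝ), (starRingEnd ℂ) (q (x + s)) * q x := by
  rw [starF, mker, ← integral_conj]
  simp [← Complex.exp_conj, gq, ← integral_conj]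

theorem qt_mul_starF_qt {a : ℝ} {q : ℝ → ℂ} (hq : Measurable q)
    (hint : IntegrableOn (fun x => Real.exp (2 * a * x) * ‖q x‖ ^ 2) (Ioi 0))
    (ζ lam : ℂ) (hw : ‖lam * ζ‖ < a) :
    qt q ζ lam * starF (qt q ((starRingEnd ℂ) ζ)) lam =
      mker q ζ lam + starF (mker q ((starRingEnd ℂ) ζ)) lam := by
  have hf : IntegrableOn (fun x : ℝ => Complex.exp (-Complex.I * lam * ζ * x) * q x) (Ioi 0) :=
    integrableOn_exp_mul_of_weighted_sq hq hint (by simpa [mul_assoc] using hw)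
  have hh : IntegrableOn
      (fun x : ℝ => Complex.exp (Complex.I * lam * ζ * x) * (starRingEnd ℂ) (q x)) (Ioi 0) :=
    integrableOn_exp_mul_of_weighted_sq (q := fun x => (starRingEnd ℂ) (q x))
      (Complex.continuous_conj.measurable.comp hq) (by simpa using hint)
      (by simpa [mul_assoc] using hw)
  rw [starF_qt, starF_mker, Complex.conj_conj, qt, mker,
    ← integral_indicator (measurableSet_Ioi (a := (0:ℝ))),
    ← integral_indicator (measurableSet_Ioi (a := (0:ℝ))),
    integral_mul_integral_eq_correlation (hf.integrable_indicator measurableSet_Ioi)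
      (hh.integrable_indicator measurableSet_Ioi)]
  congr 1
  · exact setIntegral_congr_fun measurableSet_Ioi fun s hs =>
      integral_indicator_exp_correlation _ _ _ _ (by ring) hs
  · refine setIntegral_congr_fun measurableSet_Ioi fun s hs => ?_
    simp only [mul_comm (indicator _ _ _) (indicator _ _ (_ + _))]
    exact integral_indicator_exp_correlation _ _ _ _ (by ring) hs

theorem ofReal_sqrt_three_sq : ((Real.sqrt 3 : ℝ) : ℂ) ^ 2 = 3 := by
  rw [← Complex.ofReal_pow, Real.sq_sqrt (by norm_num)]; norm_num

theorem ζ₂_mul_ζ₂ : ζ₂ * ζ₂ = ζ₃ := by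
  unfold ζ₂ ζ₃
  linear_combination (Complex.I ^ 2 / 4) * ofReal_sqrt_three_sq + (3 / 4) * Complex.I_sq

theorem ζ₂_mul_ζ₃ : ζ₂ * ζ₃ = 1 := by
  unfold ζ₂ ζ₃
  linear_combination (-Complex.I ^ 2 / 4) * ofReal_sqrt_three_sq - (3 / 4) * Complex.I_sq

theorem conj_ζ₁ : (starRingEnd ℂ) ζ₁ = ζ₁ := by simp [ζ₁]

theorem conj_ζ₂ : (starRingEnd ℂ) ζ₂ = ζ₃ := by
  simp [ζ₂, ζ₃, sub_eq_add_neg, map_ofNat]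

theorem conj_ζ₃ : (starRingEnd ℂ) ζ₃ = ζ₂ := by
  rw [← conj_ζ₂, Complex.conj_conj]

theorem norm_ζ₁ : ‖ζ₁‖ = 1 := by simp [ζ₁]

theorem norm_ζ₂ : ‖ζ₂‖ = 1 := by
  have h := Complex.mul_conj' ζ₂
  rw [conj_ζ₂, ζ₂_mul_ζ₃] at h
  exact (pow_eq_one_iff_of_nonneg (norm_nonneg _) two_ne_zero).mp (by exact_mod_cast h.symm)

theorem norm_ζ₃ : ‖ζ₃‖ = 1 := by
  rw [← conj_ζ₂, Complex.norm_conj, norm_ζ₂]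

theorem mker_mul (q : ℝ → ℂ) (ζ ω lam : ℂ) : mker q ζ (ω * lam) = mker q (ω * ζ) lam := by
  simp only [mker]
  congr! 5
  ring

theorem starF_ms0 (q : ℝ → ℂ) (lam : ℂ) :
    starF (ms0 q) lam =
      (starF (mker q ζ₁) lam + starF (mker q ζ₂) lam + starF (mker q ζ₃) lam) / 3 := by
  simp [starF, ms0, map_ofNat]

theorem starF_ms2 (q : ℝ → ℂ) (lam : ℂ) :
    starF (ms2 q) lam =
      (ζ₁ * starF (mker q ζ₁) lam + ζ₃ * starF (mker q ζ₂) lam + ζ₂ * starF (mker q ζ₃) lam) /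
        (3 * (Complex.I * lam) ^ 2) := by
  simp [starF, ms2, conj_ζ₁, conj_ζ₂, conj_ζ₃, map_ofNat]

theorem stmt14 (a : ℝ) (ha : 0 < a) (q : ℝ → ℂ) (hq : Measurable q)
    (hint : IntegrableOn (fun x => Real.exp (2 * a * x) * ‖q x‖ ^ 2) (Ioi 0))
    (lam : ℂ) (h0 : lam ≠ 0) (hlam : ‖lam‖ < a / 3) :
    ms2 q lam + starF (ms2 q) lam =
      (1 / (3 * (Complex.I * lam) ^ 2)) *
        (qt q ζ₁ lam * starF (qt q ζ₁) lam + ζ₂ * (qt q ζ₂ lam * starF (qt q ζ₃) lam) +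
          ζ₃ * (qt q ζ₃ lam * starF (qt q ζ₂) lam)) ∧
    ms0 q lam + starF (ms0 q) lam =
      (1 / 3) *
        (qt q ζ₁ lam * starF (qt q ζ₁) lam + qt q ζ₂ lam * starF (qt q ζ₃) lam +
          qt q ζ₃ lam * starF (qt q ζ₂) lam) ∧
    ms2 q (ζ₂ * lam) = ms2 q lam ∧
    ms0 q (ζ₂ * lam) = ms0 q lam := by
  have hnorm : ∀ {ζ : ℂ}, ‖ζ‖ = 1 → ‖lam * ζ‖ < a := fun h => by
    rw [norm_mul, h, mul_one]; linarith
  have h1 := qt_mul_starF_qt hq hint ζ₁ lam (hnorm norm_ζ₁)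
  have h2 := qt_mul_starF_qt hq hint ζ₂ lam (hnorm norm_ζ₂)
  have h3 := qt_mul_starF_qt hq hint ζ₃ lam (hnorm norm_ζ₃)
  rw [conj_ζ₁] at h1
  rw [conj_ζ₂] at h2
  rw [conj_ζ₃] at h3
  have hr1 : mker q ζ₁ (ζ₂ * lam) = mker q ζ₂ lam := by rw [mker_mul, ζ₁, mul_one]
  have hr2 : mker q ζ₂ (ζ₂ * lam) = mker q ζ₃ lam := by rw [mker_mul, ζ₂_mul_ζ₂]
  have hr3 : mker q ζ₃ (ζ₂ * lam) = mker q ζ₁ lam := by rw [mker_mul, ζ₂_mul_ζ₃, ζ₁]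
  refine ⟨?_, ?_, ?_, ?_⟩
  · rw [starF_ms2, h1, h2, h3, ms2, ζ₁]
    ring
  · rw [starF_ms0, h1, h2, h3, ms0]
    ring
  · have hζ : ζ₂ ≠ 0 := left_ne_zero_of_mul_eq_one ζ₂_mul_ζ₃
    have hcube : ζ₂ ^ 3 = 1 := by rw [pow_succ', pow_two, ζ₂_mul_ζ₂, ζ₂_mul_ζ₃]
    have hI := Complex.I_ne_zero
    rw [ms2, ms2, hr1, hr2, hr3, div_eq_div_iff (by simp [*]) (by simp [*]), ζ₁]
    linear_combination (-(3 * (Complex.I * lam) ^ 2)) * (mker q ζ₂ lam * hcube +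
      ζ₂ * mker q ζ₃ lam * ζ₂_mul_ζ₃ + mker q 1 lam * ζ₂_mul_ζ₂)
  · rw [ms0, ms0, hr1, hr2, hr3]
    ring
end
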